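/- Let f : ℝ⁶ → ℝ be given by f(x) = x₂ and let e₂ = (0,1,0,0,0,0). There is no C¹-diffeomorphism Φ : ℝ⁶ → ℝ⁶ with Φ(0) = e₂ such that Φ*(ω^f) = ω^f, i.e. such that for all p ∈ ℝ⁶, ω^f_p = (D_pΦ)*(ω^f_{Φ(p)}). In particular, the group of diffeomorphisms of ℝ⁶ preserving ω^f does not act transitively on ℝ⁶. -/

import Mathlib

/-- `dx3 i j k` is the alternating 3-form `dxⁱ ∧ dxʲ ∧ dxᵏ` on `ℝ⁶ = Fin 6 → ℝ`. -/
noncomputable def dx3 (i j k : Fin 6) : AlternatingMap ℝ (Fin 6 → ℝ) ℝ (Fin 3) :=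
  (Matrix.detRowAlternating : AlternatingMap ℝ (Fin 3 → ℝ) ℝ (Fin 3)).compLinearMap
    (LinearMap.funLeft ℝ ℝ ![i, j, k])

/-- For `f : ℝ⁶ → ℝ`, the field of 3-forms
`ω^f_p = dx^{135} − dx^{146} − dx^{236} + f(p)·dx^{245}` on `ℝ⁶`. -/
noncomputable def omegaF (f : (Fin 6 → ℝ) → ℝ) (p : Fin 6 → ℝ) :
    AlternatingMap ℝ (Fin 6 → ℝ) ℝ (Fin 3) :=
  dx3 0 2 4 - dx3 0 3 5 - dx3 1 2 5 + f p • dx3 1 3 4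

/-- The value of `ω^f` on a triple of vectors, in coordinates. -/
lemma omegaF_apply (f : (Fin 6 → ℝ) → ℝ) (p a b c : Fin 6 → ℝ) :
    omegaF f p ![a, b, c] =
      !![a 0, a 2, a 4; b 0, b 2, b 4; c 0, c 2, c 4].det
        - !![a 0, a 3, a 5; b 0, b 3, b 5; c 0, c 3, c 5].det
        - !![a 1, a 2, a 5; b 1, b 2, b 5; c 1, c 2, c 5].det
        + f p * !![a 1, a 3, a 4; b 1, b 3, b 4; c 1, c 3, c 4].det := by
  have key : ∀ i j k : Fin 6, dx3 i j k ![a, b, c] =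
      !![a i, a j, a k; b i, b j, b k; c i, c j, c k].det := by
    intro i j k
    change Matrix.det (fun m => LinearMap.funLeft ℝ ℝ ![i, j, k] (![a, b, c] m)) = _
    congr 1
    ext m n
    fin_cases m <;> fin_cases n <;> rfl
  simp [omegaF, key]

/-- For `s = ± 1`, the projections `ℝ⁶ → ℝ³` whose components are the factors of the two
decomposable summands of `ω^f` at a point where `f = 1`. -/
def factorProj (s : ℝ) (a : Fin 6 → ℝ) : Fin 3 → ℝ :=
  ![a 0 + s * a 1, a 2 + s * a 3, a 4 - s * a 5]

lemma factorProj_parallel {f : (Fin 6 → ℝ) → ℝ} {p a b : Fin 6 → ℝ} (hf : f p = 1)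
    (h : ∀ c, omegaF f p ![a, b, c] = 0) {s : ℝ} (hs : s ^ 2 = 1) (k l : Fin 3) :
    factorProj s a k * factorProj s b l = factorProj s a l * factorProj s b k := by
  have h0 := h ![1, s, 0, 0, 0, 0]
  have h1 := h ![0, 0, 1, s, 0, 0]
  have h2 := h ![0, 0, 0, 0, 1, -s]
  simp only [omegaF_apply, hf, Matrix.det_fin_three] at h0 h1 h2
  simp at h0 h1 h2
  rcases (sq_eq_sq_iff_eq_or_eq_neg.mp (hs.trans (one_pow 2).symm)) with rfl | rfl <;>
  fin_cases k <;> fin_cases l <;> simp [factorProj] <;> grind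

/-- Pairwise parallel vectors satisfy every linear relation that holds for suitable scalars. -/
lemma exists_functional_of_parallel {ι κ : Type*} [Fintype ι] (A : ι → κ → ℝ)
    (hA : ∀ i j k l, A i k * A j l = A i l * A j k) :
    ∃ u : ι → ℝ, ∀ x : ι → ℝ, ∑ j, x j * u j = 0 → ∀ l, ∑ j, x j * A j l = 0 := by
  by_cases h : ∃ i k, A i k ≠ 0
  · obtain ⟨i, k, hik⟩ := h
    refine ⟨fun j => A j k, fun x hx l => ?_⟩
    refine (mul_eq_zero.mp ?_).resolve_left hik
    calc A i k * ∑ j, x j * A j l = A i l * ∑ j, x j * A j k := by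
          simp only [Finset.mul_sum]
          exact Finset.sum_congr rfl fun j _ => by linear_combination x j * hA i j k l
      _ = 0 := by rw [hx, mul_zero]
  · push Not at h
    exact ⟨0, fun x _ l => by simp [h]⟩

lemma exists_ne_zero_common_kernel (u v : Fin 3 → ℝ) :
    ∃ x : Fin 3 → ℝ, x ≠ 0 ∧ ∑ j, x j * u j = 0 ∧ ∑ j, x j * v j = 0 := by
  have hd : (Matrix.of ![u, v, v]).det = 0 :=
    Matrix.det_zero_of_row_eq (i := 1) (j := 2) (by decide) rfl
  obtain ⟨x, hx, hM⟩ := Matrix.exists_mulVec_eq_zero_iff.mpr hd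
  refine ⟨x, hx, ?_, ?_⟩
  · simpa [Matrix.mulVec, dotProduct, mul_comm] using congrFun hM 0
  · simpa [Matrix.mulVec, dotProduct, mul_comm] using congrFun hM 1

/-- Three vectors that pairwise annihilate `ω^f` at a point where `f = 1` are linearly
dependent. -/
lemma exists_relation_of_annihilate {f : (Fin 6 → ℝ) → ℝ} {p : Fin 6 → ℝ} (hf : f p = 1)
    (w : Fin 3 → Fin 6 → ℝ) (h : ∀ i j c, omegaF f p ![w i, w j, c] = 0) :
    ∃ x : Fin 3 → ℝ, x ≠ 0 ∧ ∑ j, x j • w j = 0 := by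
  obtain ⟨u, hu⟩ := exists_functional_of_parallel (fun i => factorProj 1 (w i))
    fun i j => factorProj_parallel hf (h i j) (by norm_num)
  obtain ⟨v, hv⟩ := exists_functional_of_parallel (fun i => factorProj (-1) (w i))
    fun i j => factorProj_parallel hf (h i j) (by norm_num)
  obtain ⟨x, hx, hxu, hxv⟩ := exists_ne_zero_common_kernel u v
  refine ⟨x, hx, ?_⟩
  have hP := hu x hxu
  have hQ := hv x hxv
  simp only [Fin.forall_fin_succ, Fin.sum_univ_three, factorProj] at hP hQ
  simp at hP hQ
  ext m
  simp only [Fin.sum_univ_three]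
  fin_cases m <;> simp <;> linarith [hP.1, hP.2.1, hP.2.2, hQ.1, hQ.2.1, hQ.2.2]

/-- The span of `e₂, e₄, e₅` is isotropic for `ω^f` at a point where `f = 0`. -/
lemma omegaF_isotropic {f : (Fin 6 → ℝ) → ℝ} {p : Fin 6 → ℝ} (hf : f p = 0) (i j : Fin 3)
    (c : Fin 6 → ℝ) :
    omegaF f p ![Pi.single (![1, 3, 4] i) 1, Pi.single (![1, 3, 4] j) 1, c] = 0 := by
  rw [omegaF_apply, hf]
  fin_cases i <;> fin_cases j <;> simp [Matrix.det_fin_three]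

/-- `ω^f` at a zero of `f` is not the pullback of `ω^f` at a point where `f = 1` by a linear
bijection. -/
lemma omegaF_ne_compLinearMap {f : (Fin 6 → ℝ) → ℝ} {p q : Fin 6 → ℝ} (hp : f p = 0)
    (hq : f q = 1) (L : (Fin 6 → ℝ) →ₗ[ℝ] (Fin 6 → ℝ)) (hL : Function.Surjective L) :
    omegaF f p ≠ (omegaF f q).compLinearMap L := by
  intro h
  obtain ⟨x, hx, hsum⟩ := exists_relation_of_annihilate hq
    (fun i => L (Pi.single (![1, 3, 4] i) 1)) (by
      intro i j c
      obtain ⟨d, rfl⟩ := hL c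
      rw [← omegaF_isotropic hp i j d, h, AlternatingMap.compLinearMap_apply]
      congr 1
      ext m : 1
      fin_cases m <;> rfl)
  have hker : ∑ j, x j • (Pi.single (![1, 3, 4] j) 1 : Fin 6 → ℝ) = 0 :=
    LinearMap.injective_iff_surjective.mpr hL (by simpa using hsum)
  simp only [Fin.sum_univ_three] at hker
  refine hx (funext fun i => ?_)
  fin_cases i
  · simpa using congrFun hker 1
  · simpa using congrFun hker 3
  · simpa using congrFun hker 4

/-- For `f(x) = x₂`, no C¹-diffeomorphism `Φ` of `ℝ⁶` with `Φ(0) = e₂` preserves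
`ω^f`; in particular the group of diffeomorphisms preserving `ω^f` does not act
transitively on `ℝ⁶`. -/
theorem no_invariant_diffeo :
    ¬ ∃ Φ Ψ : (Fin 6 → ℝ) → (Fin 6 → ℝ),
      Function.LeftInverse Ψ Φ ∧ Function.RightInverse Ψ Φ ∧
      ContDiff ℝ 1 Φ ∧ ContDiff ℝ 1 Ψ ∧
      Φ 0 = (fun i => if i = 1 then (1 : ℝ) else 0) ∧
      (∀ p : Fin 6 → ℝ,
        omegaF (fun x => x 1) p =
          (omegaF (fun x => x 1) (Φ p)).compLinearMap (fderiv ℝ Φ p).toLinearMap) := by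
  rintro ⟨Φ, Ψ, hl, hr, hΦ, hΨ, h0, hω⟩
  have hdΦ : DifferentiableAt ℝ Φ (Ψ (Φ 0)) := hΦ.differentiable one_ne_zero _
  have hdΨ : DifferentiableAt ℝ Ψ (Φ 0) := hΨ.differentiable one_ne_zero _
  have hcomp := fderiv_comp (Φ 0) hdΦ hdΨ
  rw [hr.comp_eq_id, fderiv_id, hl 0] at hcomp
  have hsurj : Function.Surjective (fderiv ℝ Φ 0) := fun y =>
    ⟨fderiv ℝ Ψ (Φ 0) y, (DFunLike.congr_fun hcomp y).symm⟩
  exact omegaF_ne_compLinearMap (p := 0) rfl (by simp [h0]) _ hsurj (hω 0)
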